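/- Let n ≥ 2 be an even integer, let M = n³/4, and let p ∈ (0,1) be a rational number. Let T₁ = Σ_{i₁=0}^{n} Σ_{i₂=0}^{n} Σ_{i₃=0}^{n} e_{i₁} ⊗ e_{i₂} ⊗ e_{i₃} ⊗ e_{(i₁,i₂,i₃)} ∈ ℂ^{n+1} ⊗ ℂ^{n+1} ⊗ ℂ^{n+1} ⊗ ℂ^{(n+1)³} and let T₂ = Σ_{ℓ=1}^{M} e_ℓ ⊗ e_ℓ ⊗ e_ℓ ⊗ e₀ ∈ ℂ^M ⊗ ℂ^M ⊗ ℂ^M ⊗ ℂ¹. Then the limit superior, over integers N → ∞ such that pN is an integer, of R̲(T₁^{⊠pN} ⊠ T₂^{⊠(1−p)N})^{1/N} is at most ((n+1)³ + 1) · 2^{−h(p)}. (This expresses the exponent bound ω(Dome((n+1)^p; M^{1−p})) ≤ log₂((n+1)³+1) − h(p).) -/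

import Mathlib

open Finset

namespace Subadditivity

noncomputable section

/-- A tensor of order `k` over `ℂ` with `i`-th factor the space `ℂ^{ι i}` of complex-valued
functions on the finite index type `ι i`; the tensor is represented by the array of its
coordinates with respect to the standard basis, i.e. by an element of
`ℂ^{ι 0} ⊗ ⋯ ⊗ ℂ^{ι (k-1)} ≃ ((∀ i, ι i) → ℂ)`. -/
abbrev Tensor {k : ℕ} (ι : Fin k → Type) : Type := (∀ i, ι i) → ℂ

/-- `T` is a sum of `r` simple (rank-one) tensors `v j 0 ⊗ ⋯ ⊗ v j (k-1)`. -/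
def HasRankLE {k : ℕ} {ι : Fin k → Type} (T : Tensor ι) (r : ℕ) : Prop :=
  ∃ v : Fin r → (∀ i, ι i → ℂ), T = fun x => ∑ j : Fin r, ∏ i : Fin k, v j i (x i)

/-- Tensor rank: the least `r` such that `T` is a sum of `r` simple tensors. -/
noncomputable def rank {k : ℕ} {ι : Fin k → Type} (T : Tensor ι) : ℕ :=
  sInf {r | HasRankLE T r}

/-- Border rank is at most `r`: `T` lies in the closure of the set of tensors of rank `≤ r`. -/
def HasBorderRankLE {k : ℕ} {ι : Fin k → Type} (T : Tensor ι) (r : ℕ) : Prop :=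
  T ∈ closure {S : Tensor ι | HasRankLE S r}

/-- Border rank. -/
noncomputable def borderRank {k : ℕ} {ι : Fin k → Type} (T : Tensor ι) : ℕ :=
  sInf {r | HasBorderRankLE T r}

open scoped Classical in
/-- Direct sum of two tensors of order `k`: the coordinates supported on the `ι`-part are
those of `T`, the coordinates supported on the `κ`-part are those of `S`, and all mixed
coordinates vanish. -/
noncomputable def dsum {k : ℕ} {ι κ : Fin k → Type} (T : Tensor ι) (S : Tensor κ) :
    Tensor (fun i => ι i ⊕ κ i) := fun x =>
  (if h : ∃ y : ∀ i, ι i, x = fun i => Sum.inl (y i) then T h.choose else 0) +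
  (if h : ∃ z : ∀ i, κ i, x = fun i => Sum.inr (z i) then S h.choose else 0)

/-- Kronecker product of two tensors of order `k`. -/
def kron {k : ℕ} {ι κ : Fin k → Type} (T : Tensor ι) (S : Tensor κ) :
    Tensor (fun i => ι i × κ i) := fun x =>
  T (fun i => (x i).1) * S (fun i => (x i).2)

/-- `N`-th Kronecker power of a tensor of order `k`. -/
def kpow {k : ℕ} {ι : Fin k → Type} (T : Tensor ι) (N : ℕ) :
    Tensor (fun i => Fin N → ι i) := fun x => ∏ j : Fin N, T (fun i => x i j)

/-- The unit tensor `u_k(r) = Σ_{j=1}^r e_j ⊗ ⋯ ⊗ e_j` of order `k`. -/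
def unit (k r : ℕ) : Tensor (fun _ : Fin k => Fin r) := fun x =>
  ∑ j : Fin r, ∏ i : Fin k, (if x i = j then (1 : ℂ) else 0)

/-- `S` is a degeneration of `T`: `S` lies in the closure of the set of tensors obtained
from `T` by applying linear maps `A i` on each factor. -/
def Degen {k : ℕ} {ι κ : Fin k → Type} [∀ i, Fintype (κ i)]
    (S : Tensor ι) (T : Tensor κ) : Prop :=
  S ∈ closure {S' : Tensor ι | ∃ A : ∀ i, ι i → κ i → ℂ,
    S' = fun x => ∑ y : ∀ i, κ i, (∏ i : Fin k, A i (x i) (y i)) * T y}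

/-- Kronecker delta. -/
def delta {α : Type} [DecidableEq α] (a b : α) : ℂ := if a = b then 1 else 0

/-- The order-4 "spider" tensor
`Σ_{i₁,i₂,i₃} e_{i₁} ⊗ e_{i₂} ⊗ e_{i₃} ⊗ e_{(i₁,i₂,i₃)} ∈ ℂ^{m₁} ⊗ ℂ^{m₂} ⊗ ℂ^{m₃} ⊗ ℂ^{m₁m₂m₃}`,
the last factor being indexed by triples. -/
def spider3 (m₁ m₂ m₃ : ℕ) :
    Tensor ![Fin m₁, Fin m₂, Fin m₃, Fin m₁ × Fin m₂ × Fin m₃] := fun x =>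
  delta (α := Fin m₁ × Fin m₂ × Fin m₃) (x 3) (x 0, x 1, x 2)

/-- The order-4 tensor `Σ_{j=1}^N e_j ⊗ e_j ⊗ e₀ ⊗ e₀ ∈ ℂ^N ⊗ ℂ^N ⊗ ℂ¹ ⊗ ℂ¹`. -/
def matTensor4 (N : ℕ) : Tensor ![Fin N, Fin N, Fin 1, Fin 1] := fun x =>
  delta (α := Fin N) (x 0) (x 1)

/-- The order-4 tensor `Σ_{ℓ=1}^M e_ℓ ⊗ e_ℓ ⊗ e_ℓ ⊗ e₀ ∈ ℂ^M ⊗ ℂ^M ⊗ ℂ^M ⊗ ℂ¹`. -/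
def ghz4 (M : ℕ) : Tensor ![Fin M, Fin M, Fin M, Fin 1] := fun x =>
  delta (α := Fin M) (x 0) (x 1) * delta (α := Fin M) (x 1) (x 2)

/-- The binary entropy function `h(p) = −p·log₂ p − (1−p)·log₂(1−p)`. -/
def binEnt (p : ℚ) : ℝ :=
  -(p : ℝ) * Real.logb 2 (p : ℝ) - (1 - (p : ℝ)) * Real.logb 2 (1 - (p : ℝ))

/-- The filter of integers `N → ∞` such that `p·N` is an integer. -/
def pIntFilter (p : ℚ) : Filter ℕ :=
  Filter.atTop ⊓ Filter.principal {N : ℕ | ∃ m : ℕ, (m : ℚ) = p * N}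

section RankCalculus

variable {k : ℕ} {ι κ : Fin k → Type}

lemma hasRankLE_sum {J : Type} [Fintype J] (v : J → ∀ i, ι i → ℂ) :
    HasRankLE (fun x : ∀ i, ι i => ∑ j, ∏ i, v j i (x i)) (Fintype.card J) :=
  ⟨fun a => v ((Fintype.equivFin J).symm a), funext fun x =>
    (Equiv.sum_comp (Fintype.equivFin J).symm fun j => ∏ i, v j i (x i)).symm⟩

lemma HasRankLE.add {T S : Tensor ι} {r s : ℕ} (hT : HasRankLE T r) (hS : HasRankLE S s) :
    HasRankLE (T + S) (r + s) := by
  obtain ⟨v, rfl⟩ := hT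
  obtain ⟨w, rfl⟩ := hS
  refine ⟨Fin.append v w, funext fun x => ?_⟩
  simp [Fin.sum_univ_add]

lemma HasRankLE.comp {T : Tensor κ} {r : ℕ} (hT : HasRankLE T r) (φ : ∀ i, ι i → κ i) :
    HasRankLE (fun x => T fun i => φ i (x i)) r := by
  obtain ⟨v, rfl⟩ := hT
  exact ⟨fun j i a => v j i (φ i a), rfl⟩

lemma HasRankLE.kron {T : Tensor ι} {S : Tensor κ} {r s : ℕ} (hT : HasRankLE T r)
    (hS : HasRankLE S s) : HasRankLE (kron T S) (r * s) := by
  obtain ⟨v, rfl⟩ := hT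
  obtain ⟨w, rfl⟩ := hS
  have h := hasRankLE_sum (J := Fin r × Fin s)
    (fun j i (a : ι i × κ i) => v j.1 i a.1 * w j.2 i a.2)
  rw [Fintype.card_prod, Fintype.card_fin, Fintype.card_fin] at h
  convert h using 1
  funext x
  simp only [Subadditivity.kron, Fintype.sum_mul_sum, Fintype.sum_prod_type, prod_mul_distrib]

lemma HasRankLE.kpow {T : Tensor ι} {r : ℕ} (hT : HasRankLE T r) (N : ℕ) :
    HasRankLE (kpow T N) (r ^ N) := by
  obtain ⟨v, rfl⟩ := hT
  have h := hasRankLE_sum (J := Fin N → Fin r)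
    (fun f i (a : Fin N → ι i) => ∏ j, v (f j) i (a j))
  rw [Fintype.card_fun, Fintype.card_fin, Fintype.card_fin] at h
  convert h using 1
  funext x
  simp only [Subadditivity.kpow, prod_univ_sum, Fintype.piFinset_univ]
  exact sum_congr rfl fun f _ => prod_comm

lemma HasRankLE.hasBorderRankLE {T : Tensor ι} {r : ℕ} (hT : HasRankLE T r) :
    HasBorderRankLE T r := subset_closure hT

lemma isClosed_hasBorderRankLE (r : ℕ) : IsClosed {T : Tensor ι | HasBorderRankLE T r} :=
  isClosed_closure

lemma HasBorderRankLE.borderRank_le {T : Tensor ι} {r : ℕ} (hT : HasBorderRankLE T r) :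
    borderRank T ≤ r := Nat.sInf_le hT

lemma HasBorderRankLE.comp {T : Tensor κ} {r : ℕ} (hT : HasBorderRankLE T r)
    (φ : ∀ i, ι i → κ i) : HasBorderRankLE (fun x => T fun i => φ i (x i)) r :=
  map_mem_closure (f := fun (T : Tensor κ) (x : ∀ i, ι i) => T fun i => φ i (x i))
    (continuous_pi fun _ => continuous_apply _) hT fun _ hS => HasRankLE.comp hS φ

lemma HasBorderRankLE.add {T S : Tensor ι} {r s : ℕ} (hT : HasBorderRankLE T r)
    (hS : HasBorderRankLE S s) : HasBorderRankLE (T + S) (r + s) :=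
  map_mem_closure₂ continuous_add hT hS fun _ h _ h' => HasRankLE.add h h'

lemma continuous_kron :
    Continuous fun p : Tensor ι × Tensor κ => kron p.1 p.2 :=
  continuous_pi fun _ => ((continuous_apply _).comp continuous_fst).mul
    ((continuous_apply _).comp continuous_snd)

lemma HasBorderRankLE.kron {T : Tensor ι} {S : Tensor κ} {r s : ℕ} (hT : HasBorderRankLE T r)
    (hS : HasBorderRankLE S s) : HasBorderRankLE (kron T S) (r * s) :=
  map_mem_closure₂ continuous_kron hT hS fun _ h _ h' => HasRankLE.kron h h'

lemma HasBorderRankLE.kpow {T : Tensor ι} {r : ℕ} (hT : HasBorderRankLE T r) (N : ℕ) :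
    HasBorderRankLE (kpow T N) (r ^ N) :=
  map_mem_closure (f := fun T : Tensor ι => Subadditivity.kpow T N)
    (continuous_pi fun _ => continuous_finsetProd _ fun _ _ => continuous_apply _) hT
    fun _ h => HasRankLE.kpow h N

lemma HasBorderRankLE.finset_sum {J : Type} (s : Finset J) {T : J → Tensor ι} {r : ℕ}
    (hT : ∀ j, HasBorderRankLE (T j) r) : HasBorderRankLE (∑ j ∈ s, T j) (#s * r) := by
  classical
  induction s using Finset.induction_on with
  | empty => exact HasRankLE.hasBorderRankLE ⟨fun j => (Fin.cast (by simp) j : Fin 0).elim0,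
      funext fun x => by
        rw [sum_empty, sum_eq_zero fun j _ => (Fin.cast (by simp) j : Fin 0).elim0]; rfl⟩
  | insert a s ha ih =>
    rw [sum_insert ha, card_insert_of_notMem ha, add_mul, one_mul, add_comm (#s * r)]
    exact (hT a).add ih

lemma kpow_add (T : Tensor ι) (a b : ℕ) (x : ∀ i, Fin (a + b) → ι i) :
    kpow T (a + b) x =
      kpow T a (fun i j => x i (Fin.castAdd b j)) * kpow T b (fun i j => x i (Fin.natAdd a j)) :=
  Fin.prod_univ_add _

lemma hasRankLE_unit (c : ℕ) : HasRankLE (unit k c) c :=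
  ⟨fun j _ a => if a = j then 1 else 0, rfl⟩

lemma unit_const (c : ℕ) (j : Fin c) (hk : 0 < k) : unit k c (fun _ => j) = 1 := by
  simp [unit, prod_const, zero_pow hk.ne']

lemma unit_eq_zero {c : ℕ} {x : Fin k → Fin c} {i i' : Fin k} (h : x i ≠ x i') :
    unit k c x = 0 := by
  refine sum_eq_zero fun j _ => ?_
  by_cases hj : x i = j
  · exact prod_eq_zero (mem_univ i') (if_neg fun h' => h (hj.trans h'.symm))
  · exact prod_eq_zero (mem_univ i) (if_neg hj)

/-- A tensor of rank at most `c` is a restriction of `unit k c`, also after tensoring with `S`. -/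
lemma HasRankLE.kron_hasBorderRankLE {X : Tensor ι} {S : Tensor κ} {c s : ℕ}
    (hX : HasRankLE X c) (hS : HasBorderRankLE (Subadditivity.kron (unit k c) S) s) :
    HasBorderRankLE (Subadditivity.kron X S) s := by
  obtain ⟨v, rfl⟩ := hX
  let F : Tensor (fun i => Fin c × κ i) → Tensor (fun i => ι i × κ i) := fun Y x =>
    ∑ b : Fin k → Fin c, (∏ i, v (b i) i (x i).1) * Y fun i => (b i, (x i).2)
  have hF : Continuous F := continuous_pi fun x => continuous_finsetSum _ fun b _ =>
    continuous_const.mul (continuous_apply _)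
  have hmaps : ∀ Y, HasRankLE Y s → HasRankLE (F Y) s := by
    rintro _ ⟨w, rfl⟩
    refine ⟨fun j i a => ∑ b, v b i a.1 * w j i (b, a.2), funext fun x => ?_⟩
    simp only [F, prod_univ_sum, Fintype.piFinset_univ, mul_sum, prod_mul_distrib]
    exact sum_comm
  have h : HasBorderRankLE (F (Subadditivity.kron (unit k c) S)) s :=
    map_mem_closure hF hS fun Y hY => hmaps Y hY
  convert h using 1
  funext x
  simp only [F, Subadditivity.kron, unit, ← mul_assoc, ← sum_mul]
  congr 1
  simp only [mul_sum, ← prod_mul_distrib]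
  rw [sum_comm]
  refine sum_congr rfl fun j _ => ?_
  have h := prod_univ_sum (fun _ : Fin k => (univ : Finset (Fin c)))
    (fun i b => v b i (x i).1 * if b = j then (1 : ℂ) else 0)
  rw [Fintype.piFinset_univ] at h
  rw [← h]
  simp

lemma HasRankLE.kron_hasBorderRankLE_mul {X : Tensor ι} {S : Tensor κ} {q c s : ℕ}
    (hX : HasRankLE X (q * c)) (hS : HasBorderRankLE (Subadditivity.kron (unit k c) S) s) :
    HasBorderRankLE (Subadditivity.kron X S) (q * s) := by
  obtain ⟨v, rfl⟩ := hX
  have h := HasBorderRankLE.finset_sum (univ : Finset (Fin q)) (r := s)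
    (T := fun a => Subadditivity.kron
      (fun x : ∀ i, ι i => ∑ b : Fin c, ∏ i, v (finProdFinEquiv (a, b)) i (x i)) S)
    fun a => HasRankLE.kron_hasBorderRankLE ⟨_, rfl⟩ hS
  rw [card_univ, Fintype.card_fin] at h
  convert h using 1
  funext x
  rw [Finset.sum_apply]
  simp only [Subadditivity.kron, ← sum_mul]
  rw [← Fintype.sum_prod_type' (fun a b => ∏ i, v (finProdFinEquiv (a, b)) i (x i).1)]
  rw [Equiv.sum_comp finProdFinEquiv fun j => ∏ i, v j i (x i).1]

/-- If `c` copies of `T` have border rank at most `q * c`, tensoring `c` copies of `S` with `T`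
multiplies the border rank by at most `q`. -/
lemma hasBorderRankLE_copies_kron {T : Tensor ι} {S : Tensor κ} {q c s : ℕ}
    (hT : HasBorderRankLE (kron (unit k c) T) (q * c))
    (hS : HasBorderRankLE (kron (unit k c) S) s) :
    HasBorderRankLE (kron (unit k c) (kron T S)) (q * s) := by
  have h : HasBorderRankLE (kron (kron (unit k c) T) S) (q * s) :=
    closure_minimal (t := {X | HasBorderRankLE (kron X S) (q * s)})
      (fun X hX => HasRankLE.kron_hasBorderRankLE_mul hX hS)
      ((isClosed_hasBorderRankLE _).preimage
        (continuous_kron.comp (continuous_id.prodMk continuous_const))) hT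
  convert h.comp (ι := fun i => Fin c × ι i × κ i) (fun i x => ((x.1, x.2.1), x.2.2)) using 1
  funext x
  simp only [kron, mul_assoc]

lemma HasBorderRankLE.of_copies {T : Tensor ι} {c s : ℕ} (hk : 0 < k) (hc : 0 < c)
    (hT : HasBorderRankLE (Subadditivity.kron (unit k c) T) s) : HasBorderRankLE T s := by
  convert hT.comp (ι := ι) (fun i x => (⟨0, hc⟩, x)) using 1
  funext x
  simp only [Subadditivity.kron, unit_const c ⟨0, hc⟩ hk, one_mul]

/-- The power trick for `T ^ a ⊠ S ^ b` when `c` copies of it have border rank at most `q * c`. -/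
lemma hasBorderRankLE_copies_kpow {T : Tensor ι} {S : Tensor κ} {q c s a b a' b' : ℕ}
    (h : HasBorderRankLE (kron (unit k c) (kron (kpow T a) (kpow S b))) (q * c))
    (h' : HasBorderRankLE (kron (unit k c) (kron (kpow T a') (kpow S b'))) s) (m : ℕ) {A B : ℕ}
    (hA : A = m * a + a') (hB : B = m * b + b') :
    HasBorderRankLE (kron (unit k c) (kron (kpow T A) (kpow S B))) (q ^ m * s) := by
  induction m generalizing A B with
  | zero =>
    obtain rfl : A = a' := by simpa using hA
    obtain rfl : B = b' := by simpa using hB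
    simpa using h'
  | succ m ih =>
    obtain rfl : A = a + (m * a + a') := by rw [hA]; ring
    obtain rfl : B = b + (m * b + b') := by rw [hB]; ring
    rw [pow_succ', mul_assoc]
    convert (hasBorderRankLE_copies_kron h (ih rfl rfl)).comp
      (ι := fun i => Fin c × (Fin (a + (m * a + a')) → ι i) × (Fin (b + (m * b + b')) → κ i))
      (fun i x => (x.1, (fun j => x.2.1 (Fin.castAdd _ j), fun j => x.2.2 (Fin.castAdd _ j)),
        (fun j => x.2.1 (Fin.natAdd _ j), fun j => x.2.2 (Fin.natAdd _ j)))) using 1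
    funext x
    simp only [kron, kpow_add]
    ring

lemma dsum_inl (T : Tensor ι) (S : Tensor κ) (hk : 0 < k) (y : ∀ i, ι i) :
    dsum T S (fun i => Sum.inl (y i)) = T y := by
  have h : ∃ y' : ∀ i, ι i, (fun i => (Sum.inl (y i) : ι i ⊕ κ i)) = fun i => Sum.inl (y' i) :=
    ⟨y, rfl⟩
  have h' : ¬ ∃ z : ∀ i, κ i, (fun i => (Sum.inl (y i) : ι i ⊕ κ i)) = fun i => Sum.inr (z i) :=
    fun ⟨z, hz⟩ => Sum.inl_ne_inr (congrFun hz ⟨0, hk⟩)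
  rw [dsum, dif_pos h, dif_neg h', add_zero]
  congr 1
  funext i
  exact (Sum.inl_injective (congrFun h.choose_spec i)).symm

lemma dsum_inr (T : Tensor ι) (S : Tensor κ) (hk : 0 < k) (z : ∀ i, κ i) :
    dsum T S (fun i => Sum.inr (z i)) = S z := by
  have h : ∃ z' : ∀ i, κ i, (fun i => (Sum.inr (z i) : ι i ⊕ κ i)) = fun i => Sum.inr (z' i) :=
    ⟨z, rfl⟩
  have h' : ¬ ∃ y : ∀ i, ι i, (fun i => (Sum.inr (z i) : ι i ⊕ κ i)) = fun i => Sum.inl (y i) :=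
    fun ⟨y, hy⟩ => Sum.inr_ne_inl (congrFun hy ⟨0, hk⟩)
  rw [dsum, dif_pos h, dif_neg h', zero_add]
  congr 1
  funext i
  exact (Sum.inr_injective (congrFun h.choose_spec i)).symm

lemma dsum_eq_zero (T : Tensor ι) (S : Tensor κ) {x : ∀ i, ι i ⊕ κ i} {i i' : Fin k}
    (hi : (x i).isLeft) (hi' : (x i').isRight) : dsum T S x = 0 := by
  rw [dsum, dif_neg, dif_neg, add_zero]
  · rintro ⟨z, rfl⟩
    simp at hi
  · rintro ⟨y, rfl⟩
    simp at hi'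

/-- The `(a + b)`-th power of `T ⊕ S` contains `(a + b).choose a` copies of `T ^ a ⊠ S ^ b`. -/
lemma HasBorderRankLE.copies_of_dsum {T : Tensor ι} {S : Tensor κ} {D : ℕ} (hk : 0 < k)
    (h : HasBorderRankLE (dsum T S) D) (a b : ℕ) :
    HasBorderRankLE
      (Subadditivity.kron (unit k ((a + b).choose a))
        (Subadditivity.kron (Subadditivity.kpow T a) (Subadditivity.kpow S b))) (D ^ (a + b)) := by
  have hcard : Fintype.card {s : Finset (Fin (a + b)) // #s = a} = (a + b).choose a := by
    rw [Fintype.card_finset_len, Fintype.card_fin]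
  let e := (Fintype.equivFinOfCardEq hcard).symm
  have hc : ∀ s : {s : Finset (Fin (a + b)) // #s = a}, #s.1ᶜ = b := fun s => by
    rw [card_compl, s.2, Fintype.card_fin, Nat.add_sub_cancel_left]
  let E : {s : Finset (Fin (a + b)) // #s = a} → (Fin a ⊕ Fin b ≃ Fin (a + b)) :=
    fun s => finSumEquivOfFinset s.2 (hc s)
  have hE : ∀ s j, ((E s).symm j).isLeft ↔ j ∈ s.1 := by
    intro s j
    obtain ⟨z, rfl⟩ := (E s).surjective j
    rw [Equiv.symm_apply_apply]
    rcases z with z | z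
    · simp [E]
    · have := (s.1ᶜ).orderEmbOfFin_mem (hc s) z
      simpa only [E, finSumEquivOfFinset_inr, Sum.isLeft_inr, Bool.false_eq_true, false_iff,
        mem_compl] using this
  convert (h.kpow (a + b)).comp
    (ι := fun i => Fin ((a + b).choose a) × (Fin a → ι i) × (Fin b → κ i))
    (fun i x j => Sum.map x.2.1 x.2.2 ((E (e x.1)).symm j)) using 1
  funext x
  by_cases hx : ∀ i i', (x i).1 = (x i').1
  · have hconst : (fun i => (x i).1) = fun _ => (x ⟨0, hk⟩).1 := funext fun i => hx i _
    simp only [Subadditivity.kron, Subadditivity.kpow, hconst, unit_const _ _ hk, one_mul]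
    simp only [fun i => congrFun hconst i]
    rw [← Equiv.prod_comp (E (e (x ⟨0, hk⟩).1)), Fintype.prod_sum_type]
    simp only [Equiv.symm_apply_apply, Sum.map_inl, Sum.map_inr, dsum_inl T S hk,
      dsum_inr T S hk]
  · push Not at hx
    obtain ⟨i, i', hii⟩ := hx
    rw [Subadditivity.kron, unit_eq_zero hii, zero_mul]
    symm
    have hne : (e (x i).1).1 ≠ (e (x i').1).1 := fun h' => hii (e.injective (Subtype.ext h'))
    obtain ⟨j, hj⟩ : ∃ j, ¬ (j ∈ (e (x i).1).1 ↔ j ∈ (e (x i').1).1) := by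
      by_contra! h'
      exact hne (Finset.ext h')
    refine prod_eq_zero (mem_univ j) ?_
    have hmap : ∀ i, (Sum.map (x i).2.1 (x i).2.2 ((E (e (x i).1)).symm j)).isLeft ↔
        j ∈ (e (x i).1).1 := fun i => by rw [Sum.isLeft_map, hE]
    by_cases h1 : j ∈ (e (x i).1).1
    · refine dsum_eq_zero T S (i := i) (i' := i') ((hmap i).2 h1) ?_
      rw [← Sum.not_isLeft, hmap]
      tauto
    · refine dsum_eq_zero T S (i := i') (i' := i) ((hmap i').2 (by tauto)) ?_
      rw [← Sum.not_isLeft, hmap]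
      exact h1

end RankCalculus

section Dome

open Filter Topology

/-- A four-legged tensor given by an explicit sum over a finite type. -/
lemma hasRankLE_four {ι : Fin 4 → Type} {J : Type} [Fintype J] (a : J → ι 0 → ℂ)
    (b : J → ι 1 → ℂ) (c : J → ι 2 → ℂ) (d : J → ι 3 → ℂ) :
    HasRankLE (fun x : ∀ i, ι i => ∑ j, a j (x 0) * b j (x 1) * c j (x 2) * d j (x 3))
      (Fintype.card J) := by
  convert hasRankLE_sum (J := J) (ι := ι)
    (fun j i => Fin.cases (a j) (fun i => Fin.cases (b j) (fun i => Fin.cases (c j)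
      (fun i => Fin.cases (d j) (fun i => i.elim0) i) i) i) i) using 1
  funext x
  simp only [Fin.prod_univ_four]
  rfl

/-- The coordinates of `spider3 m m m ⊕ ghz4 M`. -/
def domeCoord {I L : Type} [DecidableEq I] [DecidableEq L] :
    I ⊕ L → I ⊕ L → I ⊕ L → (I × I × I) ⊕ Fin 1 → ℂ
  | .inl a, .inl b, .inl c, .inl e => if e = (a, b, c) then 1 else 0
  | .inr a, .inr b, .inr c, .inr _ => if a = b ∧ b = c then 1 else 0
  | _, _, _, _ => 0

lemma dsum_spider3_ghz4_apply (m M : ℕ)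
    (x : ∀ i : Fin 4, ![Fin m, Fin m, Fin m, Fin m × Fin m × Fin m] i ⊕
      ![Fin M, Fin M, Fin M, Fin 1] i) :
    dsum (spider3 m m m) (ghz4 M) x =
      domeCoord (I := Fin m) (L := Fin M) (x 0) (x 1) (x 2) (x 3) := by
  by_cases hl : ∀ i, (x i).isLeft
  · obtain ⟨y, rfl⟩ : ∃ y : ∀ i, ![Fin m, Fin m, Fin m, Fin m × Fin m × Fin m] i,
        x = fun i => Sum.inl (y i) :=
      ⟨fun i => (x i).getLeft (hl i), funext fun i => (Sum.inl_getLeft _ (hl i)).symm⟩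
    rw [dsum_inl _ _ (by norm_num)]
    rfl
  by_cases hr : ∀ i, (x i).isRight
  · obtain ⟨y, rfl⟩ : ∃ y : ∀ i, ![Fin M, Fin M, Fin M, Fin 1] i,
        x = fun i => Sum.inr (y i) :=
      ⟨fun i => (x i).getRight (hr i), funext fun i => (Sum.inr_getRight _ (hr i)).symm⟩
    rw [dsum_inr _ _ (by norm_num)]
    have key : ∀ a b c : Fin M, delta a b * delta b c = if a = b ∧ b = c then 1 else 0 :=
      fun a b c => by rw [delta, delta, ite_and, ite_mul, one_mul, zero_mul]
    exact key _ _ _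
  push Not at hl hr
  obtain ⟨i, hi⟩ := hl
  obtain ⟨i', hi'⟩ := hr
  rw [dsum_eq_zero _ _ (by simpa using hi') (by simpa using hi)]
  have key : ∀ (a b c : Fin m ⊕ Fin M) (d : (Fin m × Fin m × Fin m) ⊕ Fin 1),
      ¬ (a.isLeft ∧ b.isLeft ∧ c.isLeft ∧ d.isLeft) →
      ¬ (a.isRight ∧ b.isRight ∧ c.isRight ∧ d.isRight) → 0 = domeCoord a b c d := by
    rintro (a | a) (b | b) (c | c) (d | d) <;> simp [domeCoord]
  refine key _ _ _ _ (fun h => hi ?_) (fun h => hi' ?_)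
  · fin_cases i
    exacts [h.1, h.2.1, h.2.2.1, h.2.2.2]
  · fin_cases i'
    exacts [h.1, h.2.1, h.2.2.1, h.2.2.2]

/-- The Schönhage approximation for four legs: the family
`∑ (x_i + ε u_ijk) ⊗ (y_j + ε v_ijk) ⊗ (z_k + ε w_ijk) ⊗ (e_ijk + ε⁻³ e₀)
  - ε⁻³ (∑ x_i) ⊗ (∑ y_j) ⊗ (∑ z_k) ⊗ e₀`
converges to `spider ⊕ ghz` if the lower-order correlations of `u, v, w` vanish. -/
lemma tendsto_domeCoord {I L : Type} [Fintype I] [DecidableEq I] [DecidableEq L]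
    (u v w : I → I → I → L → ℂ)
    (hu : ∀ j k l, ∑ i, u i j k l = 0) (hv : ∀ i k l, ∑ j, v i j k l = 0)
    (hw : ∀ i j l, ∑ k, w i j k l = 0)
    (hvw : ∀ i l l', ∑ j, ∑ k, v i j k l * w i j k l' = 0)
    (huw : ∀ j l l', ∑ i, ∑ k, u i j k l * w i j k l' = 0)
    (huv : ∀ k l l', ∑ i, ∑ j, u i j k l * v i j k l' = 0)
    (huvw : ∀ l l' l'', ∑ i, ∑ j, ∑ k, u i j k l * v i j k l' * w i j k l'' =
      if l = l' ∧ l' = l'' then 1 else 0)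
    (x₀ x₁ x₂ : I ⊕ L) (x₃ : (I × I × I) ⊕ Fin 1) :
    Tendsto (fun ε : ℂ => (∑ j : I × I × I,
        Sum.elim (fun a => delta a j.1) (fun l => ε * u j.1 j.2.1 j.2.2 l) x₀ *
        Sum.elim (fun a => delta a j.2.1) (fun l => ε * v j.1 j.2.1 j.2.2 l) x₁ *
        Sum.elim (fun a => delta a j.2.2) (fun l => ε * w j.1 j.2.1 j.2.2 l) x₂ *
        Sum.elim (fun a => if a = j then 1 else 0) (fun _ => (ε ^ 3)⁻¹) x₃) +
      Sum.elim (fun _ => 1) (fun _ => 0) x₀ * Sum.elim (fun _ => 1) (fun _ => 0) x₁ *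
        Sum.elim (fun _ => 1) (fun _ => 0) x₂ * Sum.elim (fun _ => 0) (fun _ => -(ε ^ 3)⁻¹) x₃)
      (𝓝[≠] 0) (𝓝 (domeCoord x₀ x₁ x₂ x₃)) := by
  have hlim : ∀ (f : ℂ → ℂ) (c : ℂ), Continuous f → f 0 = c → Tendsto f (𝓝[≠] 0) (𝓝 c) :=
    fun f c hf h => h ▸ hf.continuousAt.tendsto.mono_left nhdsWithin_le_nhds
  have hconst : ∀ (f : ℂ → ℂ) (c : ℂ), (∀ ε, ε ≠ 0 → f ε = c) → Tendsto f (𝓝[≠] 0) (𝓝 c) :=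
    fun f c h => tendsto_const_nhds.congr' (by
      filter_upwards [self_mem_nhdsWithin] with ε hε using (h ε hε).symm)
  rcases x₃ with e | e
  · simp only [Sum.elim_inl, mul_ite, mul_one, mul_zero, add_zero, sum_ite_eq, mem_univ, if_true]
    refine hlim _ _ ?_ ?_
    · rcases x₀ with a | a <;> rcases x₁ with b | b <;> rcases x₂ with c | c <;>
        simp only [Sum.elim_inl, Sum.elim_inr] <;> fun_prop
    · obtain ⟨i, j, k⟩ := e
      rcases x₀ with a | a <;> rcases x₁ with b | b <;> rcases x₂ with c | c <;>
        simp [domeCoord, delta, ← ite_and, eq_comm, and_comm, and_assoc]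
  · refine hconst _ _ fun ε hε => ?_
    have sum_delta : ∀ (a : I) (f : I → ℂ), ∑ i, (delta a i) * f i = f a :=
      fun a f => by simp [delta]
    have hpair : ∀ a b : ℂ, ε * a * (ε * b) = ε ^ 2 * (a * b) := fun a b => by ring
    have htriple : ∀ a b c : ℂ, ε * a * (ε * b * (ε * c)) = ε ^ 3 * (a * b * c) :=
      fun a b c => by ring
    have hsum : ∀ f g h : I × I × I → ℂ, ∑ j, f j * g j * h j * (ε ^ 3)⁻¹ =
        (∑ i, ∑ j, ∑ k, f (i, j, k) * (g (i, j, k) * h (i, j, k))) * (ε ^ 3)⁻¹ := fun f g h => by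
      rw [← sum_mul]
      simp only [Fintype.sum_prod_type, mul_assoc]
    simp only [Sum.elim_inr]
    rw [hsum]
    rcases x₀ with a | a <;> rcases x₁ with b | b <;> rcases x₂ with c | c <;>
      simp only [Sum.elim_inl, Sum.elim_inr, domeCoord, mul_zero, zero_mul, add_zero, mul_one]
    · simp only [← mul_sum, sum_delta]
      simp [delta]
    · simp only [← mul_sum, hw, mul_zero, zero_mul, sum_const_zero]
    · simp only [fun i j k => mul_comm (ε * v i j k b) (delta c k), ← mul_sum,
        sum_delta, hv, mul_zero, zero_mul, sum_const_zero]
    · simp only [hpair, ← mul_sum, hvw, mul_zero, zero_mul, sum_const_zero]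
    · simp only [fun i j k => mul_comm (ε * u i j k a)
        ((delta b j) * (delta c k)), mul_assoc]
      simp only [← mul_sum, sum_delta, hu, mul_zero, zero_mul]
    · simp only [fun i j k => mul_left_comm (ε * u i j k a) (delta b j)]
      rw [sum_comm]
      simp only [hpair, ← mul_sum, huw, mul_zero, zero_mul, sum_const_zero]
    · simp only [fun i j k => mul_comm (ε * v i j k b) (delta c k),
        fun i j k => mul_left_comm (ε * u i j k a) (delta c k)]
      simp only [sum_delta, hpair, ← mul_sum, huv, mul_zero, zero_mul]
    · simp only [htriple, ← mul_sum, huvw]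
      field_simp

/-- A border rank decomposition of `spider3 m m m ⊕ ghz4 M` from arrays with vanishing
lower-order correlations, for any index types equivalent to `Fin m` and `Fin M`. -/
lemma hasBorderRankLE_dsum_spider3_ghz4 {m M : ℕ} {I L : Type} [Fintype I] [DecidableEq I]
    [DecidableEq L] (eI : Fin m ≃ I) (eL : Fin M ≃ L) (u v w : I → I → I → L → ℂ)
    (hu : ∀ j k l, ∑ i, u i j k l = 0) (hv : ∀ i k l, ∑ j, v i j k l = 0)
    (hw : ∀ i j l, ∑ k, w i j k l = 0)
    (hvw : ∀ i l l', ∑ j, ∑ k, v i j k l * w i j k l' = 0)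
    (huw : ∀ j l l', ∑ i, ∑ k, u i j k l * w i j k l' = 0)
    (huv : ∀ k l l', ∑ i, ∑ j, u i j k l * v i j k l' = 0)
    (huvw : ∀ l l' l'', ∑ i, ∑ j, ∑ k, u i j k l * v i j k l' * w i j k l'' =
      if l = l' ∧ l' = l'' then 1 else 0) :
    HasBorderRankLE (dsum (spider3 m m m) (ghz4 M)) (m ^ 3 + 1) := by
  let κ : Fin 4 → Type := Fin.cons (I ⊕ L) (Fin.cons (I ⊕ L) (Fin.cons (I ⊕ L)
    (Fin.cons ((I × I × I) ⊕ Fin 1) (fun i => i.elim0))))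
  let X (ε : ℂ) : Tensor κ := fun x => (∑ j : I × I × I,
        Sum.elim (fun a => delta a j.1) (fun l => ε * u j.1 j.2.1 j.2.2 l) (x 0 : I ⊕ L) *
        Sum.elim (fun a => delta a j.2.1) (fun l => ε * v j.1 j.2.1 j.2.2 l) (x 1 : I ⊕ L) *
        Sum.elim (fun a => delta a j.2.2) (fun l => ε * w j.1 j.2.1 j.2.2 l) (x 2 : I ⊕ L) *
        Sum.elim (fun a => if a = j then 1 else 0) (fun _ => (ε ^ 3)⁻¹)
          (x 3 : (I × I × I) ⊕ Fin 1)) +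
      Sum.elim (fun _ => 1) (fun _ => 0) (x 0 : I ⊕ L) *
        Sum.elim (fun _ => 1) (fun _ => 0) (x 1 : I ⊕ L) *
        Sum.elim (fun _ => 1) (fun _ => 0) (x 2 : I ⊕ L) *
        Sum.elim (fun _ => 0) (fun _ => -(ε ^ 3)⁻¹) (x 3 : (I × I × I) ⊕ Fin 1)
  have hX : ∀ ε, HasRankLE (X ε) (m ^ 3 + 1) := by
    intro ε
    have h1 := hasRankLE_four (ι := κ) (J := I × I × I)
      (fun j => Sum.elim (fun a => delta a j.1) (fun l => ε * u j.1 j.2.1 j.2.2 l))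
      (fun j => Sum.elim (fun a => delta a j.2.1) (fun l => ε * v j.1 j.2.1 j.2.2 l))
      (fun j => Sum.elim (fun a => delta a j.2.2) (fun l => ε * w j.1 j.2.1 j.2.2 l))
      (fun j => Sum.elim (fun a => if a = j then 1 else 0) (fun _ => (ε ^ 3)⁻¹))
    have h2 := hasRankLE_four (J := Unit) (ι := κ)
      (fun _ => Sum.elim (fun _ => 1) (fun _ => 0)) (fun _ => Sum.elim (fun _ => 1) (fun _ => 0))
      (fun _ => Sum.elim (fun _ => 1) (fun _ => 0))
      (fun _ => Sum.elim (fun _ => 0) (fun _ => -(ε ^ 3)⁻¹))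
    have h3 := h1.add h2
    rw [Fintype.card_unit, Fintype.card_prod, Fintype.card_prod, ← Fintype.card_congr eI,
      Fintype.card_fin, ← mul_assoc, ← pow_three'] at h3
    convert h3 using 1
    funext x
    exact congrArg₂ (· + ·) rfl (by simp)
  have hlim : HasBorderRankLE (ι := κ) (fun x => domeCoord (x 0 : I ⊕ L) (x 1 : I ⊕ L)
      (x 2 : I ⊕ L) (x 3 : (I × I × I) ⊕ Fin 1)) (m ^ 3 + 1) :=
    mem_closure_of_tendsto (f := X) (b := 𝓝[≠] (0 : ℂ))
      (tendsto_pi_nhds.2 fun x =>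
        tendsto_domeCoord u v w hu hv hw hvw huw huv huvw (x 0) (x 1) (x 2) (x 3))
      (Eventually.of_forall hX)
  let φ : ∀ i : Fin 4, ![Fin m, Fin m, Fin m, Fin m × Fin m × Fin m] i ⊕
      ![Fin M, Fin M, Fin M, Fin 1] i → κ i :=
    Fin.cons (Sum.map eI eL) (Fin.cons (Sum.map eI eL) (Fin.cons (Sum.map eI eL)
      (Fin.cons (Sum.map (Prod.map eI (Prod.map eI eI)) id) (fun i => i.elim0))))
  convert hlim.comp φ using 1
  funext x
  rw [dsum_spider3_ghz4_apply]
  have key : ∀ (a b c : Fin m ⊕ Fin M) (d : (Fin m × Fin m × Fin m) ⊕ Fin 1),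
      domeCoord a b c d = domeCoord (Sum.map eI eL a) (Sum.map eI eL b) (Sum.map eI eL c)
        (Sum.map (Prod.map eI (Prod.map eI eI)) id d) := by
    rintro (a | a) (b | b) (c | c) (d | d) <;> simp [domeCoord, Prod.ext_iff]
  exact key _ _ _ _

/-- Extend a core array by compensating entries, so that it sums to zero in the first index. -/
def extendFst {K L : Type} [Fintype K] (U : K → K → K → L → ℂ) :
    Option K → Option K → Option K → L → ℂ
  | some a, some b, some c, l => U a b c l
  | none, some b, some c, l => -∑ a, U a b c l
  | _, _, _, _ => 0

/-- Extend a core array by compensating entries, so that it sums to zero in the second index. -/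
def extendSnd {K L : Type} [Fintype K] (V : K → K → K → L → ℂ) :
    Option K → Option K → Option K → L → ℂ
  | some a, some b, some c, l => V a b c l
  | some a, none, some c, l => -∑ b, V a b c l
  | _, _, _, _ => 0

/-- Extend a core array by compensating entries, so that it sums to zero in the third index. -/
def extendThd {K L : Type} [Fintype K] (W : K → K → K → L → ℂ) :
    Option K → Option K → Option K → L → ℂ
  | some a, some b, some c, l => W a b c l
  | some a, some b, none, l => -∑ c, W a b c l
  | _, _, _, _ => 0

/-- The conditions on `u, v, w` only have to be checked on the core. -/
lemma hasBorderRankLE_dsum_of_core {m M : ℕ} {K L : Type} [Fintype K] [DecidableEq K]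
    [DecidableEq L] (eK : Fin m ≃ Option K) (eL : Fin M ≃ L) (U V W : K → K → K → L → ℂ)
    (hVW : ∀ i l l', ∑ j, ∑ k, V i j k l * W i j k l' = 0)
    (hUW : ∀ j l l', ∑ i, ∑ k, U i j k l * W i j k l' = 0)
    (hUV : ∀ k l l', ∑ i, ∑ j, U i j k l * V i j k l' = 0)
    (hUVW : ∀ l l' l'', ∑ i, ∑ j, ∑ k, U i j k l * V i j k l' * W i j k l'' =
      if l = l' ∧ l' = l'' then 1 else 0) :
    HasBorderRankLE (dsum (spider3 m m m) (ghz4 M)) (m ^ 3 + 1) := by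
  refine hasBorderRankLE_dsum_spider3_ghz4 eK eL (extendFst U) (extendSnd V) (extendThd W)
    ?_ ?_ ?_ ?_ ?_ ?_ ?_
  · rintro (_ | j) (_ | k) l <;> simp [Fintype.sum_option, extendFst]
  · rintro (_ | j) (_ | k) l <;> simp [Fintype.sum_option, extendSnd]
  · rintro (_ | j) (_ | k) l <;> simp [Fintype.sum_option, extendThd]
  · rintro (_ | i) l l' <;> simp [Fintype.sum_option, extendSnd, extendThd, hVW]
  · rintro (_ | i) l l' <;> simp [Fintype.sum_option, extendFst, extendThd, hUW]
  · rintro (_ | i) l l' <;> simp [Fintype.sum_option, extendFst, extendSnd, hUV]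
  · intro l l' l''
    simp [Fintype.sum_option, extendFst, extendSnd, extendThd, hUVW]

/-- The sign of a bit. -/
def bitSign (b : Bool) : ℂ := if b then -1 else 1

/-- The cell `(i, j, k)` of a `2h × 2h × 2h` cube belongs to the tetrahedron `l`: its `2 × 2 × 2`
block is `(l.1, l.2.1, l.2.2.1)` and the parity of its position in the block is `l.2.2.2`. -/
def tetra {H : Type} [DecidableEq H] (i j k : H × Bool) (l : H × H × H × Bool) : ℂ :=
  delta i.1 l.1 * delta j.1 l.2.1 * delta k.1 l.2.2.1 *
    delta (xor i.2 (xor j.2 k.2)) l.2.2.2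

lemma tetra_eq {H : Type} [DecidableEq H] (i j k : H × Bool) (l : H × H × H × Bool) :
    tetra i j k l = if l = (i.1, j.1, k.1, xor i.2 (xor j.2 k.2)) then 1 else 0 := by
  simp only [tetra, delta, Prod.ext_iff]
  grind

lemma sum_delta_mul {H : Type} [Fintype H] [DecidableEq H] (a : H) (f : Bool → ℂ) :
    ∑ i : H × Bool, delta i.1 a * f i.2 = ∑ α, f α := by
  simp [Fintype.sum_prod_type, delta]

lemma hasBorderRankLE_dome (n : ℕ) (he : Even n) :
    HasBorderRankLE (dsum (spider3 (n + 1) (n + 1) (n + 1)) (ghz4 (n ^ 3 / 4)))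
      ((n + 1) ^ 3 + 1) := by
  obtain ⟨h, rfl⟩ := he
  have hM : (h + h) ^ 3 / 4 = Fintype.card (Fin h × Fin h × Fin h × Bool) := by
    simp only [Fintype.card_prod, Fintype.card_fin, Fintype.card_bool]
    rw [show (h + h) ^ 3 = h * (h * (h * 2)) * 4 by ring, Nat.mul_div_cancel _ (by norm_num)]
  have hm : h + h + 1 = Fintype.card (Option (Fin h × Bool)) := by
    simp only [Fintype.card_option, Fintype.card_prod, Fintype.card_fin, Fintype.card_bool]
    ring
  have hδ : ∀ a b : Bool, delta a b = if a = b then 1 else 0 := fun _ _ => rfl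
  refine hasBorderRankLE_dsum_of_core (K := Fin h × Bool) (L := Fin h × Fin h × Fin h × Bool)
    (Fintype.equivFinOfCardEq hm.symm).symm (Fintype.equivFinOfCardEq hM.symm).symm
    (fun i j k l => bitSign j.2 * tetra i j k l) (fun i j k l => bitSign k.2 * tetra i j k l)
    (fun i j k l => bitSign i.2 * (bitSign l.2.2.2 / 4) * tetra i j k l) ?_ ?_ ?_ ?_
  · rintro ⟨i, α⟩ ⟨a, b, c, s⟩ ⟨a', b', c', s'⟩
    rw [Fintype.sum_prod_type]
    refine sum_eq_zero fun j _ => ?_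
    simp only [Fintype.sum_prod_type]
    rw [sum_comm]
    refine sum_eq_zero fun k _ => ?_
    cases α <;> cases s <;> cases s' <;> simp [tetra, bitSign, hδ]
  · rintro ⟨j, β⟩ ⟨a, b, c, s⟩ ⟨a', b', c', s'⟩
    rw [Fintype.sum_prod_type]
    refine sum_eq_zero fun i _ => ?_
    simp only [Fintype.sum_prod_type]
    rw [sum_comm]
    refine sum_eq_zero fun k _ => ?_
    cases β <;> cases s <;> cases s' <;> simp [tetra, bitSign, hδ]
  · rintro ⟨k, γ⟩ ⟨a, b, c, s⟩ ⟨a', b', c', s'⟩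
    rw [Fintype.sum_prod_type]
    refine sum_eq_zero fun i _ => ?_
    simp only [Fintype.sum_prod_type]
    rw [sum_comm]
    refine sum_eq_zero fun j _ => ?_
    cases γ <;> cases s <;> cases s' <;> simp [tetra, bitSign, hδ]
  · intro l l' l''
    split_ifs with hl
    · obtain ⟨rfl, rfl⟩ := hl
      obtain ⟨a, b, c, s⟩ := l
      have key : ∀ (i j k : Fin h × Bool) (x y z : ℂ),
          x * tetra i j k (a, b, c, s) * (y * tetra i j k (a, b, c, s)) *
            (z * tetra i j k (a, b, c, s)) = delta i.1 a * (delta j.1 b * (delta k.1 c *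
              (delta (xor i.2 (xor j.2 k.2)) s * (x * y * z)))) := by
        intro i j k x y z
        simp only [tetra, delta]
        grind
      simp only [key, ← mul_sum]
      simp only [fun i j : Fin h × Bool => sum_delta_mul c fun γ =>
        delta (xor i.2 (xor j.2 γ)) s * (bitSign j.2 * bitSign γ * (bitSign i.2 * (bitSign s / 4)))]
      simp only [fun i : Fin h × Bool => sum_delta_mul b fun β => ∑ γ,
        delta (xor i.2 (xor β γ)) s * (bitSign β * bitSign γ * (bitSign i.2 * (bitSign s / 4)))]
      rw [sum_delta_mul a fun α => ∑ β, ∑ γ,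
        delta (xor α (xor β γ)) s * (bitSign β * bitSign γ * (bitSign α * (bitSign s / 4)))]
      cases s <;> simp [bitSign, delta] <;> norm_num
    · refine sum_eq_zero fun i _ => sum_eq_zero fun j _ => sum_eq_zero fun k _ => ?_
      simp only [tetra_eq]
      grind

end Dome
section Asymptotics

open Filter Topology

lemma HasBorderRankLE.mono {k : ℕ} {ι : Fin k → Type} {T : Tensor ι} {r s : ℕ} (hk : 0 < k)
    (hT : HasBorderRankLE T r) (hrs : r ≤ s) : HasBorderRankLE T s := by
  have h0 : HasRankLE (0 : Tensor ι) (s - r) := by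
    refine ⟨fun _ _ _ => 0, ?_⟩
    funext x
    simp [prod_const, zero_pow hk.ne']
  simpa [Nat.add_sub_cancel' hrs] using hT.add h0.hasBorderRankLE

/-- Recycling: `c = (a+b choose a)` copies of `T^{⊠a} ⊠ S^{⊠b}` have border rank at most
`D^{a+b} ≤ q c`, hence `T^{⊠ma} ⊠ S^{⊠mb}` has border rank roughly `q^m`. -/
lemma HasBorderRankLE.borderRank_kpow_le {k : ℕ} {ι κ : Fin k → Type} {T : Tensor ι}
    {S : Tensor κ} {D q a b : ℕ} (hk : 0 < k) (h : HasBorderRankLE (dsum T S) D)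
    (hq : D ^ (a + b) ≤ q * (a + b).choose a) (m a' b' : ℕ) :
    borderRank (Subadditivity.kron (Subadditivity.kpow T (m * a + a'))
      (Subadditivity.kpow S (m * b + b'))) ≤ q ^ m * ((a + b).choose a * D ^ (a' + b')) := by
  have hres := (hasRankLE_unit (k := k) ((a + b).choose a)).hasBorderRankLE.kron
    ((h.copies_of_dsum hk a' b').of_copies hk (Nat.choose_pos le_self_add))
  exact ((hasBorderRankLE_copies_kpow ((h.copies_of_dsum hk a b).mono hk hq) hres m rfl
    rfl).of_copies hk (Nat.choose_pos le_self_add)).borderRank_le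

lemma factorial_mul_pow_le (a m : ℕ) : a.factorial * a ^ m ≤ m.factorial * a ^ a := by
  rcases le_total a m with h | h
  · obtain ⟨j, rfl⟩ := Nat.exists_eq_add_of_le h
    calc a.factorial * a ^ (a + j) = a.factorial * a ^ (a + j - a) * a ^ a := by
          rw [Nat.add_sub_cancel_left, pow_add, mul_assoc, mul_comm (a ^ j)]
      _ ≤ _ := Nat.mul_le_mul_right _ (Nat.factorial_mul_pow_sub_le_factorial h)
  · obtain ⟨j, rfl⟩ := Nat.exists_eq_add_of_le h
    calc (m + j).factorial * (m + j) ^ m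
        = m.factorial * (m + 1).ascFactorial j * (m + j) ^ m := by
          rw [Nat.factorial_mul_ascFactorial]
      _ ≤ m.factorial * (m + j) ^ j * (m + j) ^ m := by
          gcongr
          exact Nat.ascFactorial_le_pow_add m j
      _ = _ := by rw [mul_assoc, ← pow_add, add_comm j]

lemma add_pow_le_choose_mul (a b : ℕ) :
    (a + b) ^ (a + b) ≤ (a + b + 1) * ((a + b).choose a * (a ^ a * b ^ b)) := by
  rw [add_pow]
  refine (sum_le_card_nsmul _ _ ((a + b).choose a * (a ^ a * b ^ b)) fun m hm => ?_).trans_eq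
    (by rw [card_range, smul_eq_mul])
  obtain ⟨m', hm'⟩ := Nat.exists_eq_add_of_le (Nat.lt_succ_iff.1 (mem_range.1 hm))
  have h1 := Nat.add_choose_mul_factorial_mul_factorial a b
  have h2 := Nat.add_choose_mul_factorial_mul_factorial m m'
  rw [← Nat.choose_symm_add] at h1 h2
  rw [hm', Nat.add_sub_cancel_left]
  rw [hm'] at h1
  have ha := factorial_mul_pow_le a m
  have hb := factorial_mul_pow_le b m'
  have hpos : 0 < (a.factorial * b.factorial) * (m.factorial * m'.factorial) := by positivity
  refine le_of_mul_le_mul_right ?_ hpos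
  calc a ^ m * b ^ m' * (m + m').choose m * (a.factorial * b.factorial *
          (m.factorial * m'.factorial))
      = (m + m').choose m * m.factorial * m'.factorial *
          ((a.factorial * a ^ m) * (b.factorial * b ^ m')) := by ring
    _ ≤ (m + m').factorial * ((m.factorial * a ^ a) * (m'.factorial * b ^ b)) := by
        rw [h2]; gcongr
    _ = _ := by rw [← h1]; ring

lemma two_rpow_neg_binEnt_pow_mul (p : ℚ) (hp0 : 0 < p) (hp1 : p < 1) (a b : ℕ)
    (ha : (a : ℚ) = p * (a + b : ℕ)) :
    ((2 : ℝ) ^ (-binEnt p)) ^ (a + b) * ((a + b : ℕ) : ℝ) ^ (a + b) = (a : ℝ) ^ a * (b : ℝ) ^ b := by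
  have h0 : (0 : ℝ) < p := by exact_mod_cast hp0
  have h1 : (0 : ℝ) < 1 - p := sub_pos.2 (by exact_mod_cast hp1)
  have ha' : (a : ℝ) = p * (a + b : ℕ) := by exact_mod_cast ha
  have hb' : (b : ℝ) = (1 - p) * (a + b : ℕ) := by
    rw [sub_mul, ← ha']; push_cast; ring
  have key : ∀ x : ℝ, 0 < x → ∀ c : ℕ, (c : ℝ) = x * (a + b : ℕ) →
      ((2 : ℝ) ^ (x * Real.logb 2 x)) ^ (a + b) = x ^ c := fun x hx c hc => by
    rw [mul_comm x, Real.rpow_mul zero_le_two, Real.rpow_logb two_pos (by norm_num) hx,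
      ← Real.rpow_natCast, ← Real.rpow_mul hx.le, ← hc, Real.rpow_natCast]
  have hsplit : -binEnt p = p * Real.logb 2 p + (1 - p) * Real.logb 2 (1 - p) := by
    rw [binEnt]; ring
  rw [hsplit, Real.rpow_add two_pos, mul_pow, key _ h0 a ha', key _ h1 b hb', pow_add _ a b,
    mul_mul_mul_comm, ← mul_pow, ← mul_pow, ← ha', ← hb']

/-- `D^N / (N choose pN)` is at most `(D 2^{-h(p)})^N` up to a linear factor. -/
lemma exists_mul_choose_ge (p : ℚ) (hp0 : 0 < p) (hp1 : p < 1) (D a b : ℕ) (hD : 2 ≤ D)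
    (ha : (a : ℚ) = p * (a + b : ℕ)) :
    ∃ q : ℕ, 0 < q ∧ D ^ (a + b) ≤ q * (a + b).choose a ∧
      (q : ℝ) ≤ 2 * ((a + b : ℕ) + 1) * ((D : ℝ) * 2 ^ (-binEnt p)) ^ (a + b) := by
  set c := (a + b).choose a with hc
  have hcpos : (0 : ℝ) < c := by exact_mod_cast Nat.choose_pos le_self_add
  have hcD : (c : ℝ) ≤ (D : ℝ) ^ (a + b) := by
    have : c ≤ D ^ (a + b) := (Nat.choose_le_two_pow _ _).trans (Nat.pow_le_pow_left hD _)
    exact_mod_cast this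
  have hone : 1 ≤ (D : ℝ) ^ (a + b) / c := (one_le_div hcpos).2 hcD
  refine ⟨⌈(D : ℝ) ^ (a + b) / c⌉₊, Nat.ceil_pos.2 (by linarith), ?_, ?_⟩
  · have := (div_le_iff₀ hcpos).1 (Nat.le_ceil ((D : ℝ) ^ (a + b) / c))
    exact_mod_cast this
  have hceil : (⌈(D : ℝ) ^ (a + b) / c⌉₊ : ℝ) ≤ 2 * ((D : ℝ) ^ (a + b) / c) := by
    linarith [(Nat.ceil_lt_add_one (zero_le_one.trans hone)).le]
  refine hceil.trans ?_
  rw [mul_assoc]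
  refine mul_le_mul_of_nonneg_left ?_ zero_le_two
  rw [div_le_iff₀ hcpos, mul_pow]
  rcases Nat.eq_zero_or_pos (a + b) with h0 | hpos
  · obtain ⟨rfl, rfl⟩ : a = 0 ∧ b = 0 := by omega
    simp [hc]
  have hN : (0 : ℝ) < ((a + b : ℕ) : ℝ) ^ (a + b) := by positivity
  have hbin : ((a + b : ℕ) : ℝ) ^ (a + b) ≤
      ((a + b : ℕ) + 1) * (c * ((a : ℝ) ^ a * (b : ℝ) ^ b)) := by
    exact_mod_cast add_pow_le_choose_mul a b
  rw [← two_rpow_neg_binEnt_pow_mul p hp0 hp1 a b ha] at hbin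
  have hbin' : 1 ≤ ((a + b : ℕ) + 1) * ((c : ℝ) * ((2 : ℝ) ^ (-binEnt p)) ^ (a + b)) :=
    le_of_mul_le_mul_right (by linarith) hN
  calc (D : ℝ) ^ (a + b) = (D : ℝ) ^ (a + b) * 1 := (mul_one _).symm
    _ ≤ (D : ℝ) ^ (a + b) *
        (((a + b : ℕ) + 1) * ((c : ℝ) * ((2 : ℝ) ^ (-binEnt p)) ^ (a + b))) := by gcongr
    _ = _ := by ring

lemma pIntFilter_neBot (p : ℚ) (hp0 : 0 < p) : (pIntFilter p).NeBot := by
  refine inf_principal_neBot_iff.2 fun U hU => ?_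
  obtain ⟨N, hN⟩ := mem_atTop_sets.1 hU
  refine ⟨p.den * N, hN _ (Nat.le_mul_of_pos_left _ p.den_pos), p.num.toNat * N, ?_⟩
  have hnum : ((p.num.toNat : ℤ) : ℚ) = p.num := by
    rw [Int.toNat_of_nonneg (Rat.num_nonneg.2 hp0.le)]
  push_cast at hnum ⊢
  rw [← mul_assoc, Rat.mul_den_eq_num, hnum]

/-- Exponential bounds control the growth rate. -/
lemma limsup_rpow_le (p : ℚ) (hp0 : 0 < p) (G : ℕ → ℕ) (L : ℝ)
    (h : ∀ L' > L, ∃ C : ℝ, 0 < C ∧ 0 < L' ∧ ∀ᶠ N in pIntFilter p, (G N : ℝ) ≤ L' ^ N * C) :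
    limsup (fun N : ℕ => (G N : ℝ) ^ ((1 : ℝ) / (N : ℝ))) (pIntFilter p) ≤ L := by
  have := pIntFilter_neBot p hp0
  refine le_of_forall_gt_imp_ge_of_dense fun L'' hL'' => ?_
  obtain ⟨L', hL, hL'⟩ := exists_between hL''
  obtain ⟨C, hC, hL'0, hG⟩ := h L' hL
  have hle : pIntFilter p ≤ atTop := inf_le_left
  have hlim : Tendsto (fun N : ℕ => L' * C ^ ((1 : ℝ) / (N : ℝ))) (pIntFilter p) (𝓝 L') := by
    have h1 := (tendsto_const_div_atTop_nhds_zero_nat (1 : ℝ)).mono_left hle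
    simpa using ((tendsto_const_nhds (x := C)).rpow h1 (Or.inl hC.ne')).const_mul L'
  refine limsup_le_of_le ?_ ?_
  · exact IsCoboundedUnder.of_frequently_ge (a := 0)
      (Eventually.of_forall fun N => by positivity).frequently
  filter_upwards [hG, hlim.eventually_lt_const hL', hle (eventually_gt_atTop 0)] with N h1 h2 h3
  refine le_trans ?_ h2.le
  refine (Real.rpow_le_rpow (Nat.cast_nonneg _) h1 (by positivity)).trans_eq ?_
  rw [Real.mul_rpow (by positivity) hC.le, one_div, Real.pow_rpow_inv_natCast hL'0.le h3.ne']

lemma exists_linear_le_pow {r : ℝ} (hr : 1 < r) :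
    ∃ N₀ : ℕ, ∀ N ≥ N₀, 2 * ((N : ℝ) + 1) ≤ r ^ N := by
  have h1 := tendsto_pow_const_div_const_pow_of_one_lt 1 hr
  obtain ⟨N₀, hN₀⟩ := eventually_atTop.1
    ((h1.eventually_lt_const (show (0 : ℝ) < 1 / 4 by norm_num)).and (eventually_ge_atTop 1))
  refine ⟨N₀, fun N hN => ?_⟩
  obtain ⟨h2, h3⟩ := hN₀ N hN
  rw [pow_one, div_lt_iff₀ (by positivity)] at h2
  have h3' : (1 : ℝ) ≤ N := by exact_mod_cast h3
  linarith

lemma exists_eq_den_mul (p : ℚ) (hp0 : 0 < p) (N m : ℕ) (hm : (m : ℚ) = p * N) :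
    ∃ t, N = p.den * t ∧ m = p.num.toNat * t := by
  have hnum : (p.num.toNat : ℤ) = p.num := Int.toNat_of_nonneg (Rat.num_nonneg.2 hp0.le)
  have hpd : p * p.den = (p.num.toNat : ℕ) := by
    rw [Rat.mul_den_eq_num, ← hnum]; rfl
  have hmul : m * p.den = p.num.toNat * N := by
    have : (m : ℚ) * p.den = p.num.toNat * N := by rw [hm, ← hpd]; ring
    exact_mod_cast this
  have hcop : p.den.Coprime p.num.toNat := by
    rw [← Int.natAbs_of_nonneg (Rat.num_nonneg.2 hp0.le), Int.toNat_natCast]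
    exact p.reduced.symm
  obtain ⟨t, rfl⟩ := hcop.dvd_of_dvd_mul_left (Dvd.intro_left m hmul)
  refine ⟨t, rfl, Nat.eq_of_mul_eq_mul_right p.den_pos ?_⟩
  rw [hmul]; ring

/-- If `T ⊕ S` has border rank at most `D`, the asymptotic growth rate of the border rank of
`T^{⊠pN} ⊠ S^{⊠(1-p)N}` is at most `D 2^{-h(p)}`. -/
lemma limsup_borderRank_le {k : ℕ} {ι κ : Fin k → Type} {T : Tensor ι} {S : Tensor κ} {D : ℕ}
    (hk : 0 < k) (hD : 2 ≤ D) (h : HasBorderRankLE (dsum T S) D) (p : ℚ) (hp0 : 0 < p)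
    (hp1 : p < 1) :
    limsup (fun N : ℕ => ((borderRank (kron (kpow T (p * (N : ℚ)).num.toNat)
      (kpow S (N - (p * (N : ℚ)).num.toNat))) : ℝ)) ^ ((1 : ℝ) / (N : ℝ)))
      (pIntFilter p) ≤ (D : ℝ) * (2 : ℝ) ^ (-binEnt p) := by
  refine limsup_rpow_le p hp0 (fun N => borderRank (kron (kpow T (p * (N : ℚ)).num.toNat)
    (kpow S (N - (p * (N : ℚ)).num.toNat)))) _ fun L' hL => ?_
  set L := (D : ℝ) * (2 : ℝ) ^ (-binEnt p) with hLdef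
  have hL0 : 0 < L := mul_pos (by exact_mod_cast (by omega : 0 < D)) (by positivity)
  have hnum : (p.num.toNat : ℤ) = p.num := Int.toNat_of_nonneg (Rat.num_nonneg.2 hp0.le)
  obtain ⟨β, hβ⟩ : ∃ β, p.den = p.num.toNat + β := by
    refine Nat.exists_eq_add_of_le ?_
    have := Rat.num_lt_denom_iff.2 hp1
    omega
  set α := p.num.toNat with hα
  have hpd : (α : ℚ) = p * (α + β : ℕ) := by
    rw [← hβ, Rat.mul_den_eq_num, ← hnum]; rfl
  obtain ⟨N₀, hN₀⟩ := exists_linear_le_pow ((one_lt_div hL0).2 hL)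
  have hs : 0 < N₀ + 1 := N₀.succ_pos
  set s := N₀ + 1 with hsdef
  obtain ⟨q, hq0, hq, hqle⟩ := exists_mul_choose_ge p hp0 hp1 D (α * s) (β * s) hD (by
    rw [← add_mul, Nat.cast_mul, Nat.cast_mul, ← mul_assoc, ← hpd])
  rw [← hLdef] at hqle
  have hbig : N₀ ≤ α * s + β * s := by
    rw [← add_mul, ← hβ]
    exact (Nat.le_succ _).trans (Nat.le_mul_of_pos_left _ p.den_pos)
  have hqL : (q : ℝ) ≤ L' ^ (α * s + β * s) := by
    refine hqle.trans ((mul_le_mul_of_nonneg_right (hN₀ _ hbig) (by positivity)).trans_eq ?_)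
    rw [← mul_pow, div_mul_cancel₀ _ hL0.ne']
  have hL'0 : 0 < L' := hL0.trans hL
  have hL'1 : 1 ≤ L' := by
    by_contra! hlt
    have hne : α * s + β * s ≠ 0 := by
      rw [← add_mul, ← hβ]; exact (Nat.mul_pos p.den_pos hs).ne'
    have h1 : (1 : ℝ) ≤ q := by exact_mod_cast hq0
    linarith [pow_lt_one₀ hL'0.le hlt hne]
  have hc := Nat.choose_pos (n := α * s + β * s) (k := α * s) le_self_add
  refine ⟨((α * s + β * s).choose (α * s) * D ^ (p.den * s) : ℕ), ?_, hL'0, ?_⟩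
  · exact_mod_cast Nat.mul_pos hc (pow_pos (by omega) _)
  refine mem_inf_of_right (mem_principal.2 ?_)
  rintro N ⟨m, hm⟩
  obtain ⟨t, rfl, rfl⟩ := exists_eq_den_mul p hp0 N m hm
  have hb := h.borderRank_kpow_le hk hq (t / s) (α * (t % s)) (β * (t % s))
  have hdiv : t = t / s * s + t % s := (Nat.div_add_mod' t s).symm
  have hexp : ∀ x : ℕ, t / s * (x * s) + x * (t % s) = x * t := fun x => by
    conv_rhs => rw [hdiv]
    ring
  rw [hexp, hexp] at hb
  have hnumN : (p * ((p.den * t : ℕ) : ℚ)).num.toNat = α * t := by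
    rw [← hm]; rfl
  have hsub : p.den * t - α * t = β * t := by
    rw [hβ, add_mul, Nat.add_sub_cancel_left]
  suffices hG : ∀ A B, A = α * t → B = β * t →
      (borderRank (kron (kpow T A) (kpow S B)) : ℝ) ≤ L' ^ (p.den * t) *
        ((α * s + β * s).choose (α * s) * D ^ (p.den * s) : ℕ) from
    hG _ _ hnumN (by rw [hnumN, hsub])
  rintro _ _ rfl rfl
  calc (borderRank (kron (kpow T (α * t)) (kpow S (β * t))) : ℝ)
      ≤ ((q ^ (t / s) * ((α * s + β * s).choose (α * s) *
          D ^ (α * (t % s) + β * (t % s))) : ℕ) : ℝ) := by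
        exact_mod_cast hb
    _ ≤ ((q ^ (t / s) * ((α * s + β * s).choose (α * s) * D ^ (p.den * s)) : ℕ) : ℝ) := by
        refine Nat.cast_le.2 (Nat.mul_le_mul_left _ (Nat.mul_le_mul_left _
          (Nat.pow_le_pow_right (by omega) ?_)))
        rw [← add_mul, ← hβ]
        exact Nat.mul_le_mul_left _ (Nat.mod_lt _ hs).le
    _ = (q : ℝ) ^ (t / s) * ((α * s + β * s).choose (α * s) * D ^ (p.den * s) : ℕ) := by
        push_cast; ring
    _ ≤ L' ^ (p.den * t) * ((α * s + β * s).choose (α * s) * D ^ (p.den * s) : ℕ) := by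
        refine mul_le_mul_of_nonneg_right ?_ (Nat.cast_nonneg _)
        refine (pow_le_pow_left₀ (Nat.cast_nonneg _) hqL _).trans ?_
        rw [← pow_mul]
        refine pow_le_pow_right₀ hL'1 ?_
        rw [← add_mul, ← hβ, mul_assoc]
        exact Nat.mul_le_mul_left _ (Nat.mul_div_le t s)

end Asymptotics
/-- Theorem 4.3: exponent of the dome tensor. For `n ≥ 2` even,
`M = n³/4` and rational `p ∈ (0,1)`, the limit superior, over integers `N → ∞` with
`pN ∈ ℕ`, of `R̲(T₁^{⊠pN} ⊠ T₂^{⊠(1−p)N})^{1/N}` is at most `((n+1)³+1) · 2^{−h(p)}`. -/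
theorem exponent_dome (n : ℕ) (hn : 2 ≤ n) (he : Even n)
    (p : ℚ) (hp0 : 0 < p) (hp1 : p < 1) :
    Filter.limsup
      (fun N : ℕ =>
        ((borderRank (kron (kpow (spider3 (n + 1) (n + 1) (n + 1)) (p * (N : ℚ)).num.toNat)
            (kpow (ghz4 (n ^ 3 / 4)) (N - (p * (N : ℚ)).num.toNat))) : ℝ))
          ^ ((1 : ℝ) / (N : ℝ)))
      (pIntFilter p) ≤ (((n + 1) ^ 3 + 1 : ℕ) : ℝ) * (2 : ℝ) ^ (-binEnt p) := by
  have hD : 2 ≤ (n + 1) ^ 3 + 1 := by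
    have := Nat.one_le_pow 3 (n + 1) n.succ_pos
    omega
  exact limsup_borderRank_le four_pos hD (hasBorderRankLE_dome n he) p hp0 hp1

end
end Subadditivity
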